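/- arXiv:1507.06372 — 9 statements merged into one kernel-verified Lean document; each statement's English description precedes it below -/
import Mathlib

section
/- Let F be a field of characteristic 0. In the polynomial ring F[x₁,…,x₆], the radical of the ideal generated by the nine polynomials x₂ + x₃, x₁ + x₄, x₆, x₁², x₂x₁, x₁x₅ + x₂, x₂², x₅x₂ + x₁, x₅² − 1 equals the ideal generated by the six polynomials x₁, x₂, x₃, x₄, x₆, x₅² − 1. -/
open MvPolynomial

/-- Modulo the ideal `(x₁, x₂, x₃, x₄, x₆, x₅² - 1)`, every polynomial is congruent to one of the
form `a + b x₅`. -/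
theorem exists_sub_linear_mem_span {F : Type*} [Field F] (p : MvPolynomial (Fin 6) F) :
    ∃ a b : F, p - (C a + C b * X 4) ∈
      (Ideal.span {X 0, X 1, X 2, X 3, X 5, (X 4) ^ 2 - 1} : Ideal (MvPolynomial (Fin 6) F)) := by
  induction p using MvPolynomial.induction_on with
  | C a => exact ⟨a, 0, by simp⟩
  | add p q hp hq =>
    obtain ⟨a, b, h⟩ := hp
    obtain ⟨c, d, h'⟩ := hq
    refine ⟨a + c, b + d, ?_⟩
    convert Ideal.add_mem _ h h' using 1
    simp only [C_add]
    ring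
  | mul_X p i hp =>
    obtain ⟨a, b, h⟩ := hp
    by_cases hi : i = 4
    · subst hi
      have hsq : (X 4 ^ 2 - 1 : MvPolynomial (Fin 6) F) ∈
          Ideal.span {X 0, X 1, X 2, X 3, X 5, (X 4) ^ 2 - 1} := Ideal.subset_span (by simp)
      refine ⟨b, a, ?_⟩
      convert Ideal.add_mem _ (Ideal.mul_mem_right (X 4) _ h) (Ideal.mul_mem_left _ (C b) hsq)
        using 1
      ring
    · refine ⟨0, 0, ?_⟩
      simp only [C_0, zero_mul, add_zero, sub_zero]
      refine Ideal.mul_mem_left _ _ (Ideal.subset_span ?_)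
      fin_cases i <;> simp at hi ⊢

/-- In `F[x₁,…,x₆]` (variables `X 0, …, X 5` correspond to `x₁, …, x₆`), the radical of the
ideal generated by `x₂+x₃, x₁+x₄, x₆, x₁², x₂x₁, x₁x₅+x₂, x₂², x₅x₂+x₁, x₅²−1` equals the
ideal generated by `x₁, x₂, x₃, x₄, x₆, x₅²−1`. -/
theorem radical_DI85 (F : Type*) [Field F] [CharZero F] :
    (Ideal.span {X 1 + X 2, X 0 + X 3, X 5, (X 0) ^ 2, X 1 * X 0, X 0 * X 4 + X 1,
        (X 1) ^ 2, X 4 * X 1 + X 0, (X 4) ^ 2 - 1} :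
      Ideal (MvPolynomial (Fin 6) F)).radical =
    Ideal.span {X 0, X 1, X 2, X 3, X 5, (X 4) ^ 2 - 1} := by
  set I : Ideal (MvPolynomial (Fin 6) F) :=
    Ideal.span {X 1 + X 2, X 0 + X 3, X 5, (X 0) ^ 2, X 1 * X 0, X 0 * X 4 + X 1,
        (X 1) ^ 2, X 4 * X 1 + X 0, (X 4) ^ 2 - 1} with hI
  apply le_antisymm
  · intro p hp
    have eval_eq_zero (e : F) (he : e ^ 2 = 1) : eval ![0, 0, 0, 0, e, 0] p = 0 := by
      have hle : I ≤ RingHom.ker (eval ![0, 0, 0, 0, e, 0]) := by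
        rw [hI, Ideal.span_le]
        rintro q (rfl | rfl | rfl | rfl | rfl | rfl | rfl | rfl | rfl) <;>
          simp [RingHom.mem_ker, he]
      exact (RingHom.ker_isPrime _).isRadical.radical_le_iff.2 hle hp
    have eval_eq_zero_of_mem (e : F) (he : e ^ 2 = 1) (q : MvPolynomial (Fin 6) F)
        (hq : q ∈ Ideal.span {X 0, X 1, X 2, X 3, X 5, (X 4) ^ 2 - 1}) :
        eval ![0, 0, 0, 0, e, 0] q = 0 := by
      have hle : Ideal.span {X 0, X 1, X 2, X 3, X 5, (X 4) ^ 2 - 1} ≤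
          RingHom.ker (eval ![0, 0, 0, 0, e, 0]) := by
        rw [Ideal.span_le]
        rintro q (rfl | rfl | rfl | rfl | rfl | rfl) <;> simp [RingHom.mem_ker, he]
      exact hle hq
    obtain ⟨a, b, h⟩ := exists_sub_linear_mem_span p
    have h₁ := eval_eq_zero_of_mem 1 (by simp) _ h
    have h₂ := eval_eq_zero_of_mem (-1) (by simp) _ h
    rw [map_sub, eval_eq_zero _ (by simp)] at h₁ h₂
    simp at h₁ h₂
    have ha : a = 0 := by linear_combination (-1 / 2) * h₁ - (1 / 2) * h₂
    have hb : b = 0 := by linear_combination (-1 / 2) * h₁ + (1 / 2) * h₂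
    simpa [ha, hb] using h
  · have h0 : X 0 ∈ I.radical := ⟨2, Ideal.subset_span (by simp)⟩
    have h1 : X 1 ∈ I.radical := ⟨2, Ideal.subset_span (by simp)⟩
    have h12 : X 1 + X 2 ∈ I.radical := I.le_radical (Ideal.subset_span (by simp))
    have h03 : X 0 + X 3 ∈ I.radical := I.le_radical (Ideal.subset_span (by simp))
    rw [Ideal.span_le]
    rintro q (rfl | rfl | rfl | rfl | rfl | rfl)
    · exact h0
    · exact h1
    · exact (Ideal.add_mem_iff_right _ h1).1 h12
    · exact (Ideal.add_mem_iff_right _ h0).1 h03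
    · exact I.le_radical (Ideal.subset_span (by simp))
    · exact I.le_radical (Ideal.subset_span (by simp))
end

section
/- Let F be a field of characteristic 0. There exists a nonzero polynomial P ∈ F[x₁,…,x₆] with the following property: for every (a₁,…,a₆) ∈ F⁶ with P(a₁,…,a₆) ≠ 0 and every nonunital nonassociative algebra A over F whose multiplication satisfies the identity (b₁b₂)b₃ = a₁·b₁(b₂b₃) + a₂·b₁(b₃b₂) + a₃·b₂(b₁b₃) + a₄·b₂(b₃b₁) + a₅·b₃(b₁b₂) + a₆·b₃(b₂b₁) for all b₁,b₂,b₃ ∈ A, every product of four elements of A vanishes; that is, for all b₁,b₂,b₃,b₄ ∈ A one has ((b₁b₂)b₃)b₄ = 0, (b₁(b₂b₃))b₄ = 0, (b₁b₂)(b₃b₄) = 0, b₁((b₂b₃)b₄) = 0 and b₁(b₂(b₃b₄)) = 0. -/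
universe u

open Finset

namespace QuaternaryRelations

/-- The five ways to bracket a product of four factors. -/
def monomial {A : Type*} [Mul A] (s : Fin 5) (x : Fin 4 → A) : A :=
  ![((x 0 * x 1) * x 2) * x 3, (x 0 * (x 1 * x 2)) * x 3, (x 0 * x 1) * (x 2 * x 3),
    x 0 * ((x 1 * x 2) * x 3), x 0 * (x 1 * (x 2 * x 3))] s

/-- A bracketing together with a word in four letters: a multilinear monomial when the word is a
permutation. -/
abbrev Term : Type := Fin 5 × (Fin 4 → Fin 4)

/-- The seven terms of each of the five quaternary consequences of the ternary relation `r`: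
`r(x₀x₁, x₂, x₃)`, `r(x₀, x₁x₂, x₃)`, `r(x₀, x₁, x₂x₃)`, `r(x₀, x₁, x₂)x₃`, `x₀r(x₁, x₂, x₃)`. -/
def term : Fin 5 → Fin 7 → Term :=
  ![![(0, ![0, 1, 2, 3]), (2, ![0, 1, 2, 3]), (2, ![0, 1, 3, 2]), (3, ![2, 0, 1, 3]),
      (4, ![2, 3, 0, 1]), (3, ![3, 0, 1, 2]), (4, ![3, 2, 0, 1])],
    ![(1, ![0, 1, 2, 3]), (3, ![0, 1, 2, 3]), (4, ![0, 3, 1, 2]), (2, ![1, 2, 0, 3]),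
      (2, ![1, 2, 3, 0]), (4, ![3, 0, 1, 2]), (3, ![3, 1, 2, 0])],
    ![(2, ![0, 1, 2, 3]), (4, ![0, 1, 2, 3]), (3, ![0, 2, 3, 1]), (4, ![1, 0, 2, 3]),
      (3, ![1, 2, 3, 0]), (2, ![2, 3, 0, 1]), (2, ![2, 3, 1, 0])],
    ![(0, ![0, 1, 2, 3]), (1, ![0, 1, 2, 3]), (1, ![0, 2, 1, 3]), (1, ![1, 0, 2, 3]),
      (1, ![1, 2, 0, 3]), (1, ![2, 0, 1, 3]), (1, ![2, 1, 0, 3])],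
    ![(3, ![0, 1, 2, 3]), (4, ![0, 1, 2, 3]), (4, ![0, 1, 3, 2]), (4, ![0, 2, 1, 3]),
      (4, ![0, 2, 3, 1]), (4, ![0, 3, 1, 2]), (4, ![0, 3, 2, 1])]]

/-- The coefficients of the ternary relation, with all terms moved to the left-hand side. -/
def coeff {R : Type*} [Ring R] (a : Fin 6 → R) : Fin 7 → R :=
  Fin.cons 1 (-a)

/-- The matrix whose rows are the quaternary consequences of the ternary relation, for all
substitutions of letters. -/
def relationMatrix {R : Type*} [Ring R] (a : Fin 6 → R) : Matrix Term Term R :=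
  fun j k => ∑ i, if ((term j.1 i).1, j.2 ∘ (term j.1 i).2) = k then coeff a i else 0

theorem sum_relationMatrix_smul {R M : Type*} [Ring R] [AddCommGroup M] [Module R M]
    (a : Fin 6 → R) (v : Term → M) (j : Term) :
    ∑ k, relationMatrix a j k • v k =
      ∑ i, coeff a i • v ((term j.1 i).1, j.2 ∘ (term j.1 i).2) := by
  simp only [relationMatrix, sum_smul]
  rw [sum_comm]
  simp [ite_smul]

theorem map_relationMatrix {R S : Type*} [Ring R] [Ring S] (f : R →+* S) (a : Fin 6 → R) :
    f.mapMatrix (relationMatrix a) = relationMatrix (f ∘ a) := by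
  have hc (i : Fin 7) : f (coeff a i) = coeff (f ∘ a) i := by
    refine Fin.cases ?_ (fun i => ?_) i <;> simp [coeff]
  ext j k
  simp [relationMatrix, apply_ite f, hc]

theorem sum_coeff_smul_monomial {R A : Type*} [CommRing R] [NonUnitalNonAssocRing A] [Module R A]
    [SMulCommClass R A A] [IsScalarTower R A A] (a : Fin 6 → R)
    (h : ∀ b₁ b₂ b₃ : A, (b₁ * b₂) * b₃ =
      a 0 • (b₁ * (b₂ * b₃)) + a 1 • (b₁ * (b₃ * b₂)) +
      a 2 • (b₂ * (b₁ * b₃)) + a 3 • (b₂ * (b₃ * b₁)) +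
      a 4 • (b₃ * (b₁ * b₂)) + a 5 • (b₃ * (b₂ * b₁)))
    (x : Fin 4 → A) (r : Fin 5) :
    ∑ i, coeff a i • monomial (term r i).1 (x ∘ (term r i).2) = 0 := by
  have terms {y p₀ p₁ p₂ p₃ p₄ p₅ : A}
      (hy : y = a 0 • p₀ + a 1 • p₁ + a 2 • p₂ + a 3 • p₃ + a 4 • p₄ + a 5 • p₅)
      (ht : ∀ i, monomial (term r i).1 (x ∘ (term r i).2) = ![y, p₀, p₁, p₂, p₃, p₄, p₅] i) :
      ∑ i, coeff a i • monomial (term r i).1 (x ∘ (term r i).2) = 0 := by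
    simp only [ht]
    rw [Fin.sum_univ_succ]
    simp only [coeff, Fin.cons_zero, Fin.cons_succ, Matrix.cons_val_zero, Matrix.cons_val_succ]
    simp [Fin.sum_univ_six, hy]
  fin_cases r
  · exact terms (h (x 0 * x 1) (x 2) (x 3)) (by intro i; fin_cases i <;> rfl)
  · exact terms (h (x 0) (x 1 * x 2) (x 3)) (by intro i; fin_cases i <;> rfl)
  · exact terms (h (x 0) (x 1) (x 2 * x 3)) (by intro i; fin_cases i <;> rfl)
  · have hy := congrArg (· * x 3) (h (x 0) (x 1) (x 2))
    simp only [add_mul, smul_mul_assoc] at hy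
    exact terms hy (by intro i; fin_cases i <;> rfl)
  · have hy := congrArg (x 0 * ·) (h (x 1) (x 2) (x 3))
    simp only [mul_add, mul_smul_comm] at hy
    exact terms hy (by intro i; fin_cases i <;> rfl)

/-- The relation `(b₁b₂)b₃ = -b₁(b₂b₃)` forces all products of four elements to vanish. -/
theorem det_relationMatrix_antiassociative_ne_zero {F : Type*} [Field F] [NeZero (2 : F)] :
    (relationMatrix (Pi.single 0 (-1) : Fin 6 → F)).det ≠ 0 := by
  intro hdet
  obtain ⟨v, hv0, hv⟩ := Matrix.exists_mulVec_eq_zero_iff.mpr hdet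
  have rel (r : Fin 5) (w : Fin 4 → Fin 4) :
      v ((term r 0).1, w ∘ (term r 0).2) + v ((term r 1).1, w ∘ (term r 1).2) = 0 := by
    have h := congrFun hv (r, w)
    change ∑ k, relationMatrix (Pi.single 0 (-1) : Fin 6 → F) (r, w) k • v k = 0 at h
    rw [sum_relationMatrix_smul, Fin.sum_univ_succ, Fin.sum_univ_succ] at h
    simpa [coeff, Pi.single_apply] using h
  have id_word (w : Fin 4 → Fin 4) : w ∘ ![0, 1, 2, 3] = w := by
    funext i
    fin_cases i <;> rfl
  apply hv0
  funext ⟨s, w⟩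
  have h₀ : v (0, w) + v (2, w) = 0 := by simpa [term, id_word] using rel 0 w
  have h₁ : v (1, w) + v (3, w) = 0 := by simpa [term, id_word] using rel 1 w
  have h₂ : v (2, w) + v (4, w) = 0 := by simpa [term, id_word] using rel 2 w
  have h₃ : v (0, w) + v (1, w) = 0 := by simpa [term, id_word] using rel 3 w
  have h₄ : v (3, w) + v (4, w) = 0 := by simpa [term, id_word] using rel 4 w
  have h : v (4, w) = 0 := by
    have : (2 : F) * v (4, w) = 0 := by linear_combination -h₀ + h₂ + h₃ - h₁ + h₄
    exact (mul_eq_zero.mp this).resolve_left (NeZero.ne 2)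
  fin_cases s <;> simp only [Pi.zero_apply] <;> grind

theorem eq_zero_of_sum_smul_eq_zero {F M n : Type*} [Field F] [AddCommGroup M] [Module F M]
    [Fintype n] [DecidableEq n] {B : Matrix n n F} (hB : B.det ≠ 0) {v : n → M}
    (h : ∀ j, ∑ k, B j k • v k = 0) (i : n) : v i = 0 := by
  have hinv : B⁻¹ * B = 1 := Matrix.nonsing_inv_mul B (isUnit_iff_ne_zero.mpr hB)
  calc v i = ∑ k, (B⁻¹ * B) i k • v k := by simp [hinv, Matrix.one_apply]
    _ = ∑ j, B⁻¹ i j • ∑ k, B j k • v k := by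
      simp only [Matrix.mul_apply, sum_smul, smul_sum, mul_smul]
      exact sum_comm
    _ = 0 := by simp [h]

end QuaternaryRelations

open QuaternaryRelations

/-- Nilpotency theorem: there is a nonzero polynomial `P ∈ F[x₁,…,x₆]` such that for every
parameter value `a ∈ F⁶` with `P(a) ≠ 0`, every nonunital nonassociative `F`-algebra
satisfying the parametrized one-relation identity with parameters `a` has all products of
four elements equal to zero. -/
theorem nilpotency_theorem (F : Type u) [Field F] [CharZero F] :
    ∃ P : MvPolynomial (Fin 6) F, P ≠ 0 ∧
      ∀ a : Fin 6 → F, MvPolynomial.eval a P ≠ 0 →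
        ∀ (A : Type u) [NonUnitalNonAssocRing A] [Module F A]
          [SMulCommClass F A A] [IsScalarTower F A A],
          (∀ b₁ b₂ b₃ : A, (b₁ * b₂) * b₃ =
              a 0 • (b₁ * (b₂ * b₃)) + a 1 • (b₁ * (b₃ * b₂)) +
              a 2 • (b₂ * (b₁ * b₃)) + a 3 • (b₂ * (b₃ * b₁)) +
              a 4 • (b₃ * (b₁ * b₂)) + a 5 • (b₃ * (b₂ * b₁))) →
          ∀ b₁ b₂ b₃ b₄ : A,
            ((b₁ * b₂) * b₃) * b₄ = 0 ∧ (b₁ * (b₂ * b₃)) * b₄ = 0 ∧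
            (b₁ * b₂) * (b₃ * b₄) = 0 ∧ b₁ * ((b₂ * b₃) * b₄) = 0 ∧
            b₁ * (b₂ * (b₃ * b₄)) = 0 := by
  have heval (a : Fin 6 → F) :
      MvPolynomial.eval a (relationMatrix (MvPolynomial.X (R := F))).det =
        (relationMatrix a).det := by
    rw [RingHom.map_det, map_relationMatrix]
    congr 2
    funext i
    simp
  refine ⟨(relationMatrix MvPolynomial.X).det, fun h => ?_, ?_⟩
  · apply det_relationMatrix_antiassociative_ne_zero (F := F)
    rw [← heval, h, map_zero]
  · intro a ha A _ _ _ _ hA b₁ b₂ b₃ b₄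
    rw [heval] at ha
    have hzero (s : Fin 5) : monomial s ![b₁, b₂, b₃, b₄] = 0 :=
      eq_zero_of_sum_smul_eq_zero ha
        (v := fun k : Term => monomial k.1 (![b₁, b₂, b₃, b₄] ∘ k.2))
        (fun j => by
          rw [sum_relationMatrix_smul]
          exact sum_coeff_smul_monomial a hA (![b₁, b₂, b₃, b₄] ∘ j.2) j.1) (s, id)
    exact ⟨hzero 0, hzero 1, hzero 2, hzero 3, hzero 4⟩
end

section
/- Let F be a field of characteristic 0 and let A be a nonunital nonassociative algebra over F satisfying the anti-associative identity (ab)c = −a(bc) for all a,b,c ∈ A. Then all products of four elements of A vanish: for all a,b,c,d ∈ A one has ((ab)c)d = 0, (a(bc))d = 0, (ab)(cd) = 0, a((bc)d) = 0, and a(b(cd)) = 0. -/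
/-- A nonunital nonassociative algebra over a field of characteristic zero satisfying the
anti-associative identity `(ab)c = −a(bc)` has all products of four elements equal to zero. -/
theorem antiassociative_nilpotent (F : Type*) [Field F] [CharZero F]
    (A : Type*) [NonUnitalNonAssocRing A] [Module F A]
    [SMulCommClass F A A] [IsScalarTower F A A]
    (h : ∀ a b c : A, (a * b) * c = -(a * (b * c))) :
    ∀ a b c d : A,
      ((a * b) * c) * d = 0 ∧ (a * (b * c)) * d = 0 ∧ (a * b) * (c * d) = 0 ∧
      a * ((b * c) * d) = 0 ∧ a * (b * (c * d)) = 0 := by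
  intro a b c d
  have hleft : ((a * b) * c) * d = a * (b * (c * d)) := by
    rw [h (a * b) c d, h a b (c * d), neg_neg]
  have hright : ((a * b) * c) * d = -(a * (b * (c * d))) := by
    rw [h a b c, neg_mul, h a (b * c) d, neg_neg, h b c d, mul_neg]
  have hzero : a * (b * (c * d)) = 0 := by
    have htwo : (2 : F) • (a * (b * (c * d))) = 0 := by
      rw [two_smul, add_eq_zero_iff_eq_neg, ← hright, hleft]
    exact (smul_eq_zero.mp htwo).resolve_left two_ne_zero
  refine ⟨by rw [hleft, hzero], ?_, by rw [h, hzero, neg_zero], ?_, hzero⟩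
  · rw [h, h b c d, mul_neg, neg_neg, hzero]
  · rw [h b c d, mul_neg, hzero, neg_zero]
end

section
/- Let F be a field of characteristic 0. The set of points (x₁,x₂,x₃,x₄) ∈ F⁴ satisfying simultaneously the ten polynomial equations x₁⁴ − x₁³ = 0, x₄⁴ + x₁³ − x₁² = 0, x₂³ − x₂² = 0, x₃³ + x₃² = 0, x₁x₂ − x₂² = 0, x₁x₃ + x₃² = 0, x₂x₃ = 0, x₁x₄ = 0, x₂x₄ = 0, x₃x₄ = 0 is exactly the four-element set {(0,0,0,0), (1,0,0,0), (1,1,0,0), (1,0,−1,0)}. -/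
/-- The common zero set in `F⁴` of the ten polynomials
`x₁⁴−x₁³, x₄⁴+x₁³−x₁², x₂³−x₂², x₃³+x₃², x₁x₂−x₂², x₁x₃+x₃², x₂x₃, x₁x₄, x₂x₄, x₃x₄`
is exactly `{(0,0,0,0), (1,0,0,0), (1,1,0,0), (1,0,−1,0)}`. -/
theorem zeroSet_four_operads (F : Type*) [Field F] [CharZero F] (x₁ x₂ x₃ x₄ : F) :
    (x₁ ^ 4 - x₁ ^ 3 = 0 ∧ x₄ ^ 4 + x₁ ^ 3 - x₁ ^ 2 = 0 ∧ x₂ ^ 3 - x₂ ^ 2 = 0 ∧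
      x₃ ^ 3 + x₃ ^ 2 = 0 ∧ x₁ * x₂ - x₂ ^ 2 = 0 ∧ x₁ * x₃ + x₃ ^ 2 = 0 ∧
      x₂ * x₃ = 0 ∧ x₁ * x₄ = 0 ∧ x₂ * x₄ = 0 ∧ x₃ * x₄ = 0) ↔
    ((x₁, x₂, x₃, x₄) = (0, 0, 0, 0) ∨ (x₁, x₂, x₃, x₄) = (1, 0, 0, 0) ∨
      (x₁, x₂, x₃, x₄) = (1, 1, 0, 0) ∨ (x₁, x₂, x₃, x₄) = (1, 0, -1, 0)) := by
  simp only [Prod.mk.injEq]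
  constructor
  · rintro ⟨h₁, h₂, -, -, h₅, h₆, h₇, h₈, -, -⟩
    have hx₁ : x₁ = 0 ∨ x₁ = 1 := by
      have h : x₁ ^ 3 * (x₁ - 1) = 0 := by linear_combination h₁
      rcases mul_eq_zero.mp h with h | h
      · exact Or.inl (eq_zero_of_pow_eq_zero h)
      · exact Or.inr (sub_eq_zero.mp h)
    rcases hx₁ with rfl | rfl
    · have hx₂ : x₂ = 0 := by simpa using h₅
      have hx₃ : x₃ = 0 := by simpa using h₆
      have hx₄ : x₄ = 0 := by simpa using h₂
      exact Or.inl ⟨rfl, hx₂, hx₃, hx₄⟩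
    · have hx₄ : x₄ = 0 := by simpa using h₈
      have hx₂ : x₂ = 0 ∨ x₂ = 1 := by
        have h : x₂ * (x₂ - 1) = 0 := by linear_combination -h₅
        simpa [sub_eq_zero] using h
      have hx₃ : x₃ = 0 ∨ x₃ = -1 := by
        have h : x₃ * (x₃ + 1) = 0 := by linear_combination h₆
        simpa [add_eq_zero_iff_eq_neg] using h
      rcases hx₂ with rfl | rfl
      · rcases hx₃ with rfl | rfl <;> simp [hx₄]
      · have hx₃' : x₃ = 0 := by simpa using h₇
        simp [hx₃', hx₄]
  · rintro (⟨rfl, rfl, rfl, rfl⟩ | ⟨rfl, rfl, rfl, rfl⟩ | ⟨rfl, rfl, rfl, rfl⟩ |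
      ⟨rfl, rfl, rfl, rfl⟩) <;> norm_num
end

section
/- Let F be a field of characteristic 0. In F[x₁,x₂,x₃,x₄], the radical of the ideal I generated by the seven polynomials x₄, x₂(x₂−x₁), x₃x₂, x₃(x₃+x₁), x₁²(x₁−1), x₂x₁(x₁−1), x₃x₁(x₁−1) equals the ideal J generated by the seven polynomials x₄, x₁(x₁−1), x₂(x₁−1), x₃(x₁−1), x₂(x₂−1), x₃x₂, x₃(x₃+1); moreover the common zero set of J in F⁴ is exactly the four-element set {(0,0,0,0), (1,0,0,0), (1,1,0,0), (1,0,−1,0)}. -/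
open MvPolynomial

theorem Ideal.exists_ker_eq.{u} {R : Type u} [CommRing R] (I : Ideal R) :
    ∃ (A : Type u) (_ : CommRing A) (φ : R →+* A), RingHom.ker φ = I :=
  ⟨R ⧸ I, inferInstance, Ideal.Quotient.mk I, Ideal.mk_ker⟩

theorem MvPolynomial.forall_mem_span_eval_eq_zero_iff {σ R : Type*} [CommRing R]
    (S : Set (MvPolynomial σ R)) (x : σ → R) :
    (∀ f ∈ Ideal.span S, eval x f = 0) ↔ ∀ f ∈ S, eval x f = 0 :=
  Ideal.span_le (I := RingHom.ker (eval x))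

theorem MvPolynomial.mul_sub_C_eval_mem {σ R : Type*} [CommRing R]
    {J : Ideal (MvPolynomial σ R)} {e : MvPolynomial σ R} {p : σ → R}
    (h : ∀ i, e * (X i - C (p i)) ∈ J) (f : MvPolynomial σ R) :
    e * (f - C (eval p f)) ∈ J := by
  induction f using MvPolynomial.induction_on with
  | C a => simp
  | add f g hf hg =>
    convert J.add_mem hf hg using 1
    simp only [map_add]
    ring
  | mul_X f i hf =>
    convert J.add_mem (J.mul_mem_left (X i) hf) (J.mul_mem_left (C (eval p f)) (h i)) using 1
    simp only [map_mul, eval_X]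
    ring

/-- An ideal is radical if `1` is a sum of elements `e k`, each of which is multiplied into
the ideal by the functions vanishing at a common zero `p k`. -/
theorem MvPolynomial.isRadical_of_sum_eq_one {σ ι R : Type*} [Fintype ι] [CommRing R]
    [IsReduced R] {J : Ideal (MvPolynomial σ R)} (e : ι → MvPolynomial σ R) (p : ι → σ → R)
    (hsum : ∑ k, e k = 1) (hp : ∀ k, ∀ f ∈ J, eval (p k) f = 0)
    (he : ∀ k i, e k * (X i - C (p k i)) ∈ J) : J.IsRadical := by
  rintro f ⟨n, hn⟩
  rw [← one_mul f, ← hsum, Finset.sum_mul]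
  refine J.sum_mem fun k _ => ?_
  have hf : eval (p k) f = 0 := by
    have := hp k _ hn
    rw [map_pow] at this
    exact eq_zero_of_pow_eq_zero this
  simpa [hf] using mul_sub_C_eval_mem (he k) f

/-- In `F[x₁,x₂,x₃,x₄]` (variables `X 0, X 1, X 2, X 3` correspond to `x₁, x₂, x₃, x₄`),
the radical of the ideal generated by
`x₄, x₂(x₂−x₁), x₃x₂, x₃(x₃+x₁), x₁²(x₁−1), x₂x₁(x₁−1), x₃x₁(x₁−1)` equals the ideal `J`
generated by `x₄, x₁(x₁−1), x₂(x₁−1), x₃(x₁−1), x₂(x₂−1), x₃x₂, x₃(x₃+1)`; moreover the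
common zero set of `J` in `F⁴` is exactly `{(0,0,0,0), (1,0,0,0), (1,1,0,0), (1,0,−1,0)}`. -/
theorem radical_and_zeroSet_x5x6zero (F : Type*) [Field F] [CharZero F] :
    ((Ideal.span {X 3, X 1 * (X 1 - X 0), X 2 * X 1, X 2 * (X 2 + X 0),
        (X 0) ^ 2 * (X 0 - 1), X 1 * X 0 * (X 0 - 1), X 2 * X 0 * (X 0 - 1)} :
      Ideal (MvPolynomial (Fin 4) F)).radical =
      Ideal.span {X 3, X 0 * (X 0 - 1), X 1 * (X 0 - 1), X 2 * (X 0 - 1),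
        X 1 * (X 1 - 1), X 2 * X 1, X 2 * (X 2 + 1)}) ∧
    (∀ x : Fin 4 → F,
      (∀ f ∈ (Ideal.span {X 3, X 0 * (X 0 - 1), X 1 * (X 0 - 1), X 2 * (X 0 - 1),
          X 1 * (X 1 - 1), X 2 * X 1, X 2 * (X 2 + 1)} :
        Ideal (MvPolynomial (Fin 4) F)), MvPolynomial.eval x f = 0) ↔
      (x = ![0, 0, 0, 0] ∨ x = ![1, 0, 0, 0] ∨ x = ![1, 1, 0, 0] ∨ x = ![1, 0, -1, 0])) := by
  have zeros (x : Fin 4 → F) :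
      (∀ f ∈ (Ideal.span {X 3, X 0 * (X 0 - 1), X 1 * (X 0 - 1), X 2 * (X 0 - 1),
          X 1 * (X 1 - 1), X 2 * X 1, X 2 * (X 2 + 1)} :
        Ideal (MvPolynomial (Fin 4) F)), MvPolynomial.eval x f = 0) ↔
      (x = ![0, 0, 0, 0] ∨ x = ![1, 0, 0, 0] ∨ x = ![1, 1, 0, 0] ∨ x = ![1, 0, -1, 0]) := by
    rw [forall_mem_span_eval_eq_zero_iff]
    simp only [Set.mem_insert_iff, Set.mem_singleton_iff, forall_eq_or_imp, forall_eq, map_mul,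
      map_sub, map_add, map_one, eval_X, funext_iff, Fin.forall_fin_succ, IsEmpty.forall_iff]
    simp
    grind
  refine ⟨?_, zeros⟩
  set I : Ideal (MvPolynomial (Fin 4) F) := Ideal.span {X 3, X 1 * (X 1 - X 0), X 2 * X 1,
    X 2 * (X 2 + X 0), (X 0) ^ 2 * (X 0 - 1), X 1 * X 0 * (X 0 - 1), X 2 * X 0 * (X 0 - 1)}
    with hI
  set J : Ideal (MvPolynomial (Fin 4) F) := Ideal.span {X 3, X 0 * (X 0 - 1), X 1 * (X 0 - 1),
    X 2 * (X 0 - 1), X 1 * (X 1 - 1), X 2 * X 1, X 2 * (X 2 + 1)} with hJ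
  obtain ⟨A, _, φ, hφ⟩ := I.exists_ker_eq
  obtain ⟨B, _, ψ, hψ⟩ := J.exists_ker_eq
  have relI := Ideal.span_le.mp (hI.symm.trans hφ.symm).le
  have relJ := Ideal.span_le.mp (hJ.symm.trans hψ.symm).le
  clear_value I J
  simp only [Set.insert_subset_iff, Set.singleton_subset_iff, SetLike.mem_coe,
    RingHom.mem_ker, map_mul, map_sub, map_add, map_one, map_pow] at relI relJ
  apply le_antisymm
  · have hrad : J.IsRadical := by
      refine isRadical_of_sum_eq_one ![1 - X 0, X 0 - X 1 + X 2, X 1, -X 2]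
        ![![0, 0, 0, 0], ![1, 0, 0, 0], ![1, 1, 0, 0], ![1, 0, -1, 0]] ?_ ?_ ?_
      · simp only [Fin.sum_univ_four, Matrix.cons_val]
        ring
      · intro k
        rw [zeros]
        fin_cases k <;> simp
      · clear zeros hI hφ relI
        simp only [← hψ, RingHom.mem_ker, Fin.forall_fin_succ, IsEmpty.forall_iff]
        simp
        generalize ψ (X 0) = a, ψ (X 1) = b, ψ (X 2) = c, ψ (X 3) = d at *
        clear hψ hJ
        grind
    refine hrad.radical_le_iff.mpr (hI.trans_le (Ideal.span_le.mpr ?_))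
    simp only [Set.insert_subset_iff, Set.singleton_subset_iff, SetLike.mem_coe, ← hψ,
      RingHom.mem_ker, map_mul, map_sub, map_add, map_one, map_pow]
    clear zeros hI hφ relI hψ hJ hrad
    generalize ψ (X 0) = a, ψ (X 1) = b, ψ (X 2) = c, ψ (X 3) = d at *
    grind
  · have sq_mem {f : MvPolynomial (Fin 4) F} (hf : φ f ^ 2 = 0) : f ∈ I.radical :=
      ⟨2, by rwa [← hφ, RingHom.mem_ker, map_pow]⟩
    refine hJ.trans_le (Ideal.span_le.mpr ?_)
    simp only [Set.insert_subset_iff, Set.singleton_subset_iff, SetLike.mem_coe]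
    refine ⟨sq_mem ?_, sq_mem ?_, sq_mem ?_, sq_mem ?_, sq_mem ?_, sq_mem ?_, sq_mem ?_⟩ <;>
      try simp only [map_mul, map_sub, map_add, map_one]
    all_goals
      clear zeros hI hφ hψ hJ relJ sq_mem
      generalize φ (X 0) = a, φ (X 1) = b, φ (X 2) = c, φ (X 3) = d at *
      grind
end

section
/- Let F be a field of characteristic 0. The set of points (x₁,x₃,x₅,x₆) ∈ F⁴ with x₁ ≠ 0, x₃ ≠ 0, x₅ ≠ 0 and x₆ ≠ 0 satisfying simultaneously the nine polynomial equations (3x₁−1)(x₃−x₁) = 0, 3x₆x₁ − 3x₅x₁ + 2x₃ + x₁ = 0, (x₃−x₁)(x₃+x₁) = 0, (x₅−1)(x₃+x₁) = 0, 3x₆x₃ + 3x₅x₁ − 2x₃ − x₁ = 0, 3x₅x₆ − x₁ + x₃ = 0, x₁(x₅−1)(3x₁−1) = 0, 9x₅²x₁ + 3x₅x₁ − 5x₃ − 7x₁ = 0, 9x₆³ + 18x₅x₁ − 9x₆ − 11x₃ − 7x₁ = 0 is exactly the two-element set {(1/3, −1/3, −2/3, −1/3), (1/3, −1/3, 1/3,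 2/3)}. -/
/-- The set of points `(x₁,x₃,x₅,x₆) ∈ F⁴` with all coordinates nonzero satisfying the nine
listed equations is exactly `{(1/3, −1/3, −2/3, −1/3), (1/3, −1/3, 1/3, 2/3)}`. -/
theorem six_param_case2 (F : Type*) [Field F] [CharZero F] (x₁ x₃ x₅ x₆ : F) :
    (x₁ ≠ 0 ∧ x₃ ≠ 0 ∧ x₅ ≠ 0 ∧ x₆ ≠ 0 ∧
      (3 * x₁ - 1) * (x₃ - x₁) = 0 ∧
      3 * x₆ * x₁ - 3 * x₅ * x₁ + 2 * x₃ + x₁ = 0 ∧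
      (x₃ - x₁) * (x₃ + x₁) = 0 ∧
      (x₅ - 1) * (x₃ + x₁) = 0 ∧
      3 * x₆ * x₃ + 3 * x₅ * x₁ - 2 * x₃ - x₁ = 0 ∧
      3 * x₅ * x₆ - x₁ + x₃ = 0 ∧
      x₁ * (x₅ - 1) * (3 * x₁ - 1) = 0 ∧
      9 * x₅ ^ 2 * x₁ + 3 * x₅ * x₁ - 5 * x₃ - 7 * x₁ = 0 ∧
      9 * x₆ ^ 3 + 18 * x₅ * x₁ - 9 * x₆ - 11 * x₃ - 7 * x₁ = 0) ↔
    ((x₁, x₃, x₅, x₆) = (1/3, -(1/3), -(2/3), -(1/3)) ∨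
      (x₁, x₃, x₅, x₆) = (1/3, -(1/3), 1/3, 2/3)) := by
  have three_ne : (3 : F) ≠ 0 := three_ne_zero
  simp only [Prod.mk.injEq]
  constructor
  · rintro ⟨-, -, h₅, h₆, e₁, e₂, e₃, -, -, e₆, -, e₈, -⟩
    have hne : x₃ - x₁ ≠ 0 := fun h =>
      mul_ne_zero (mul_ne_zero three_ne h₅) h₆ (by linear_combination e₆ - h)
    have h₁ : x₁ = 1 / 3 := by
      have := (mul_eq_zero.mp e₁).resolve_right hne
      linear_combination this / 3
    have h₃ : x₃ = -(1 / 3) := by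
      have := (mul_eq_zero.mp e₃).resolve_left hne
      linear_combination this - h₁
    subst h₁ h₃
    have h₆₅ : x₆ = x₅ + 1 / 3 := by linear_combination e₂
    have hquad : (3 * x₅ + 2) * (3 * x₅ - 1) = 0 := by linear_combination 3 * e₈
    rcases mul_eq_zero.mp hquad with h | h
    · exact Or.inl ⟨rfl, rfl, by linear_combination h / 3, by linear_combination h₆₅ + h / 3⟩
    · exact Or.inr ⟨rfl, rfl, by linear_combination h / 3, by linear_combination h₆₅ + h / 3⟩
  · rintro (⟨rfl, rfl, rfl, rfl⟩ | ⟨rfl, rfl, rfl, rfl⟩) <;> norm_num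
end

section
/- Let F be a field of characteristic 0. The set of points (x₁,x₃,x₅,x₆) ∈ F⁴ with x₁ ≠ 0, x₃ ≠ 0, x₅ ≠ 0 and x₆ ≠ 0 satisfying simultaneously the six polynomial equations x₆ + x₅ − x₃ − x₁ + 1 = 0, (x₅−x₃)(2x₅−x₃−x₁+2) = 0, 2x₃²x₁ − 2x₁³ + x₅x₃ − x₃² − x₅x₁ + 3x₃x₁ + 4x₁² − 2x₁ = 0, 6x₅x₃x₁ + 6x₅x₁² − 6x₃x₁² − 6x₁³ + x₅x₃ − x₃² − 5x₅x₁ + 11x₃x₁ + 12x₁² − 6x₁ = 0, 2x₃³ − 2x₃x₁² − x₅x₃ + 3x₃² + x₅x₁ + 3x₃x₁ − 2x₃ = 0, 2x₅x₃² − 2x₅x₁² − x₅x₃ + 3x₃² + x₅x₁ + 3x₃x₁ − 2x₃ = 0 is exactly the union of the single point (1/3, 1/3, −2/3, 1/3) and the family {(x₁, x₃, x₃, x₁−1) : x₁, x₃ ∈ F, x₃² + x₃ − (x₁−1)² = 0, x₁ ≠ 0, x₁ ≠ 1}. -/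
/-- The set of points `(x₁,x₃,x₅,x₆) ∈ F⁴` with all coordinates nonzero satisfying the six
listed equations is exactly the union of the single point `(1/3, 1/3, −2/3, 1/3)` and the
family `{(x₁, x₃, x₃, x₁−1) : x₃² + x₃ − (x₁−1)² = 0, x₁ ≠ 0, x₁ ≠ 1}`. -/
theorem six_param_case1 (F : Type*) [Field F] [CharZero F] (x₁ x₃ x₅ x₆ : F) :
    (x₁ ≠ 0 ∧ x₃ ≠ 0 ∧ x₅ ≠ 0 ∧ x₆ ≠ 0 ∧
      x₆ + x₅ - x₃ - x₁ + 1 = 0 ∧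
      (x₅ - x₃) * (2 * x₅ - x₃ - x₁ + 2) = 0 ∧
      2 * x₃ ^ 2 * x₁ - 2 * x₁ ^ 3 + x₅ * x₃ - x₃ ^ 2 - x₅ * x₁ + 3 * x₃ * x₁ +
        4 * x₁ ^ 2 - 2 * x₁ = 0 ∧
      6 * x₅ * x₃ * x₁ + 6 * x₅ * x₁ ^ 2 - 6 * x₃ * x₁ ^ 2 - 6 * x₁ ^ 3 + x₅ * x₃ -
        x₃ ^ 2 - 5 * x₅ * x₁ + 11 * x₃ * x₁ + 12 * x₁ ^ 2 - 6 * x₁ = 0 ∧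
      2 * x₃ ^ 3 - 2 * x₃ * x₁ ^ 2 - x₅ * x₃ + 3 * x₃ ^ 2 + x₅ * x₁ + 3 * x₃ * x₁ -
        2 * x₃ = 0 ∧
      2 * x₅ * x₃ ^ 2 - 2 * x₅ * x₁ ^ 2 - x₅ * x₃ + 3 * x₃ ^ 2 + x₅ * x₁ + 3 * x₃ * x₁ -
        2 * x₃ = 0) ↔
    ((x₁, x₃, x₅, x₆) = (1/3, 1/3, -(2/3), 1/3) ∨
      (x₃ ^ 2 + x₃ - (x₁ - 1) ^ 2 = 0 ∧ x₅ = x₃ ∧ x₆ = x₁ - 1 ∧ x₁ ≠ 0 ∧ x₁ ≠ 1)) := by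
  constructor
  · rintro ⟨h1, h3, -, h6, e1, e2, e3, -, e5, e6⟩
    by_cases h : x₅ = x₃
    · subst h
      have hx₆ : x₆ = x₁ - 1 := by linear_combination e1
      refine Or.inr ⟨?_, rfl, hx₆, h1, fun h' => h6 (by rw [hx₆, h', sub_self])⟩
      have : 2 * x₁ * (x₅ ^ 2 + x₅ - (x₁ - 1) ^ 2) = 0 := by linear_combination e3
      exact (mul_eq_zero.mp this).resolve_left (mul_ne_zero two_ne_zero h1)
    · have hd : x₅ - x₃ ≠ 0 := sub_ne_zero.mpr h
      have e2' : 2 * x₅ - x₃ - x₁ + 2 = 0 := (mul_eq_zero.mp e2).resolve_left hd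
      have hprod : 2 * (x₅ - x₃) * ((x₃ + x₁) * (x₃ - x₁)) = 0 := by
        linear_combination e6 - e5
      have hfac := (mul_eq_zero.mp hprod).resolve_left (mul_ne_zero two_ne_zero hd)
      -- On the factor `x₃ + x₁ = 0` the coordinate `x₆` vanishes.
      have hsum : x₃ + x₁ ≠ 0 := by
        intro hs
        have : 2 * x₆ = 0 := by linear_combination 2 * e1 - e2' + hs
        exact h6 ((mul_eq_zero.mp this).resolve_left two_ne_zero)
      have hx₃ : x₃ = x₁ := sub_eq_zero.mp ((mul_eq_zero.mp hfac).resolve_left hsum)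
      subst hx₃
      have hlin : 2 * x₃ * (3 * x₃ - 1) = 0 := by linear_combination e3
      have h3x : 3 * x₃ - 1 = 0 :=
        (mul_eq_zero.mp hlin).resolve_left (mul_ne_zero two_ne_zero h3)
      have hx₃ : x₃ = 1 / 3 := by linear_combination h3x / 3
      have hx₅ : x₅ = -(2 / 3) := by linear_combination e2' / 2 + hx₃
      have hx₆ : x₆ = 1 / 3 := by linear_combination e1 - hx₅ + 2 * hx₃
      exact Or.inl (by rw [hx₅, hx₆, hx₃])
  · rintro (h | ⟨h, rfl, rfl, h1, h1'⟩)
    · simp only [Prod.mk.injEq] at h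
      obtain ⟨rfl, rfl, rfl, rfl⟩ := h
      norm_num
    · have h5 : x₅ ≠ 0 := by
        rintro rfl
        have : (x₁ - 1) ^ 2 = 0 := by linear_combination -h
        exact h1' (sub_eq_zero.mp (pow_eq_zero_iff two_ne_zero |>.mp this))
      refine ⟨h1, h5, h5, sub_ne_zero.mpr h1', by ring, by ring, ?_, ?_, ?_, ?_⟩
      · linear_combination 2 * x₁ * h
      · linear_combination 6 * x₁ * h
      · linear_combination 2 * x₅ * h
      · linear_combination 2 * x₅ * h
end

section
/- Let F be an algebraically closed field of characteristic 0 and let s ∈ F. Then there exists t ∈ F with t ≠ 1, t ≠ −1, 3st + t² + t + 1 ≠ 0 and st² − st + s + t = 0 if and only if s ≠ −1 and s ≠ 1/3. -/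
/-- Change-of-basis computation for the one-parameter family interpolating between the
associative and Poisson operads: over an algebraically closed field of characteristic zero,
a parameter `t` with `t ≠ ±1`, `3st + t² + t + 1 ≠ 0` and `st² − st + s + t = 0` exists
if and only if `s ≠ −1` and `s ≠ 1/3`. -/
theorem change_of_basis_assoc_poisson (F : Type*) [Field F] [IsAlgClosed F] [CharZero F]
    (s : F) :
    (∃ t : F, t ≠ 1 ∧ t ≠ -1 ∧ 3 * s * t + t ^ 2 + t + 1 ≠ 0 ∧
      s * t ^ 2 - s * t + s + t = 0) ↔ (s ≠ -1 ∧ s ≠ 1/3) := by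
  constructor
  · rintro ⟨t, h1, h2, -, h⟩
    refine ⟨?_, ?_⟩
    · rintro rfl
      have : (t - 1) ^ 2 = 0 := by linear_combination -h
      exact h1 (sub_eq_zero.mp (pow_eq_zero_iff two_ne_zero |>.mp this))
    · rintro rfl
      have : (t + 1) ^ 2 = 0 := by linear_combination 3 * h
      exact h2 (eq_neg_of_add_eq_zero_left (pow_eq_zero_iff two_ne_zero |>.mp this))
  · rintro ⟨hs1, hs3⟩
    obtain ⟨t, h⟩ : ∃ t : F, s * t ^ 2 - s * t + s + t = 0 := by
      rcases eq_or_ne s 0 with rfl | hs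
      · exact ⟨0, by ring⟩
      · obtain ⟨z, hz⟩ := IsAlgClosed.exists_pow_nat_eq (discrim s (1 - s) s) two_pos
        obtain ⟨t, ht⟩ := exists_quadratic_eq_zero hs ⟨z, by rw [← hz, sq]⟩
        exact ⟨t, by linear_combination ht⟩
    have h1 : t ≠ 1 := by
      rintro rfl
      exact hs1 (by linear_combination h)
    have h2 : t ≠ -1 := by
      rintro rfl
      exact hs3 (by linear_combination h / 3)
    refine ⟨t, h1, h2, fun hD => ?_, h⟩
    have : ((t - 1) * (t + 1)) ^ 2 = 0 := by
      linear_combination (t ^ 2 - t + 1) * hD - 3 * t * h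
    rcases mul_eq_zero.mp (pow_eq_zero_iff two_ne_zero |>.mp this) with h' | h'
    · exact h1 (sub_eq_zero.mp h')
    · exact h2 (eq_neg_of_add_eq_zero_left h')
end

section
/- Let F be an algebraically closed field of characteristic 0 and let u,v ∈ F satisfy v² − v − (u−1)² = 0. Then there exists t ∈ F with t ≠ 1, t ≠ −1, ut + vt − t + 1 ≠ 0, 1 + t − 3ut + 3vt ≠ 0 and u²t² + 2u²t − 2ut − v²t² − 2v²t − vt² − v = 0 if and only if (u,v) ≠ (1,1) and (u,v) ≠ (1/3, −1/3). -/
/-- On the hyperbola, `(2(u - v) - 1) v = -(u - v - 1)²`. -/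
lemma hyperbola_param {F : Type*} [Field F] {u v : F}
    (huv : v ^ 2 - v - (u - 1) ^ 2 = 0) :
    (2 * (u - v) - 1) * v = -(u - v - 1) ^ 2 := by
  linear_combination -huv

lemma hyperbola_denom_ne_zero {F : Type*} [Field F] [CharZero F] {u v : F}
    (huv : v ^ 2 - v - (u - 1) ^ 2 = 0) : 2 * (u - v) - 1 ≠ 0 := by
  intro h
  have h1 : (u - v - 1) ^ 2 = 0 := by
    linear_combination hyperbola_param huv - v * h
  have h2 : u - v - 1 = 0 := pow_eq_zero_iff two_ne_zero |>.mp h1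
  exact one_ne_zero (α := F) (by linear_combination h - 2 * h2)

/-- On the hyperbola, the numerator of the transformed parameter is a perfect square
up to the factor `2(u - v) - 1`. -/
lemma hyperbola_numerator_sq {F : Type*} [Field F] {u v : F}
    (huv : v ^ 2 - v - (u - 1) ^ 2 = 0) (t : F) :
    (2 * (u - v) - 1) * (u ^ 2 * t ^ 2 + 2 * u ^ 2 * t - 2 * u * t - v ^ 2 * t ^ 2 -
      2 * v ^ 2 * t - v * t ^ 2 - v) = ((2 * (u - v) - 1) * t + (u - v - 1)) ^ 2 := by
  linear_combination (1 - (2 * (u - v) - 1) * (t ^ 2 + 2 * t)) * huv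

lemma hyperbola_exceptional_iff {F : Type*} [Field F] [CharZero F] {u v : F}
    (huv : v ^ 2 - v - (u - 1) ^ 2 = 0) :
    ((u, v) ≠ (1, 1) ∧ (u, v) ≠ (1/3, -(1/3))) ↔ (u - v ≠ 0 ∧ 3 * (u - v) - 2 ≠ 0) := by
  have hp := hyperbola_param huv
  simp only [ne_eq, Prod.mk.injEq]
  refine and_congr (not_congr ⟨?_, fun h => ?_⟩) (not_congr ⟨?_, fun h => ?_⟩)
  · rintro ⟨rfl, rfl⟩
    ring
  · have hv : v = 1 := by linear_combination -hp + (u + v - 2) * h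
    exact ⟨by linear_combination h + hv, hv⟩
  · rintro ⟨rfl, rfl⟩
    norm_num
  · have hs : u - v = 2 / 3 := by linear_combination h / 3
    rw [hs] at hp
    have hv : v = -(1 / 3) := by linear_combination 3 * hp
    exact ⟨by linear_combination hs + hv, hv⟩


/-- Change-of-basis computation for the hyperbola families: over an algebraically closed
field of characteristic zero, if `v² − v − (u−1)² = 0`, then a parameter `t` with `t ≠ ±1`,
`ut + vt − t + 1 ≠ 0`, `1 + t − 3ut + 3vt ≠ 0` and
`u²t² + 2u²t − 2ut − v²t² − 2v²t − vt² − v = 0` exists if and only if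
`(u,v) ≠ (1,1)` and `(u,v) ≠ (1/3, −1/3)`. -/
theorem change_of_basis_hyperbola (F : Type*) [Field F] [IsAlgClosed F] [CharZero F]
    (u v : F) (huv : v ^ 2 - v - (u - 1) ^ 2 = 0) :
    (∃ t : F, t ≠ 1 ∧ t ≠ -1 ∧ u * t + v * t - t + 1 ≠ 0 ∧
      1 + t - 3 * u * t + 3 * v * t ≠ 0 ∧
      u ^ 2 * t ^ 2 + 2 * u ^ 2 * t - 2 * u * t - v ^ 2 * t ^ 2 - 2 * v ^ 2 * t -
        v * t ^ 2 - v = 0) ↔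
    ((u, v) ≠ (1, 1) ∧ (u, v) ≠ (1/3, -(1/3))) := by
  have hd := hyperbola_denom_ne_zero huv
  have hp := hyperbola_param huv
  rw [hyperbola_exceptional_iff huv]
  constructor
  · rintro ⟨t, ht1, ht2, -, -, hq⟩
    have hsq : ((2 * (u - v) - 1) * t + (u - v - 1)) ^ 2 = 0 := by
      rw [← hyperbola_numerator_sq huv, hq, mul_zero]
    have hlin : (2 * (u - v) - 1) * t + (u - v - 1) = 0 :=
      pow_eq_zero_iff two_ne_zero |>.mp hsq
    refine ⟨fun h => ht2 ?_, fun h => ht1 (mul_left_cancel₀ hd ?_)⟩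
    · linear_combination -hlin + (2 * t + 1) * h
    · linear_combination hlin - h
  · rintro ⟨h0, h2⟩
    obtain ⟨t, ht⟩ : ∃ t, (2 * (u - v) - 1) * t + (u - v - 1) = 0 :=
      ⟨(1 - (u - v)) / (2 * (u - v) - 1), by field_simp; ring⟩
    refine ⟨t, ?_, ?_, fun h => ?_, fun h => ?_, ?_⟩
    · rintro rfl
      exact h2 (by linear_combination ht)
    · rintro rfl
      exact h0 (by linear_combination -ht)
    · refine mul_ne_zero h0 h2 ?_
      linear_combination (2 * (u - v) - 1) ^ 2 * h
        - (2 * (u - v) - 1) * (u + v - 1) * ht + 2 * (u - v - 1) * hp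
    · refine mul_ne_zero h0 h2 ?_
      linear_combination (2 * (u - v) - 1) * h - (1 - 3 * (u - v)) * ht
    · refine (mul_eq_zero_iff_left hd).mp ?_
      rw [hyperbola_numerator_sq huv, ht]
      ring
end
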